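/- arXiv:math/0506629 — 6 statements merged into one kernel-verified Lean document; each statement's English description precedes it below -/
import Mathlib

section
/- A = K + R is diagonalizable on V: V is the internal direct sum of the eigenspaces of A; the set of distinct eigenvalues of A on V is exactly { q^{2i−d} : 0 ≤ i ≤ d }; and for 0 ≤ i ≤ d the dimension of ker(A − q^{2i−d}I) equals the dimension of U_i. -/
/-- If `B` `q`-commutes with a nilpotent `N` (`B N = q² N B`), the `q`-exponential of `N`
conjugates `B` to `B + N B`. -/
theorem exists_isUnit_conj_of_q_commute {𝕂 S : Type*} [Field 𝕂] [Ring S] [Algebra 𝕂 S]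
    {q : 𝕂} (hq : ∀ n : ℕ, 0 < n → q ^ n ≠ 1) {B N : S} (hBN : B * N = q ^ 2 • (N * B))
    {m : ℕ} (hN : N ^ (m + 1) = 0) :
    ∃ E : S, IsUnit E ∧ (B + N * B) * E = E * B := by
  have hpow (n : ℕ) : B * N ^ n = q ^ (2 * n) • (N ^ n * B) := by
    induction n with
    | zero => simp
    | succ n ih =>
      rw [pow_succ, ← mul_assoc, ih, smul_mul_assoc, mul_assoc, hBN, mul_smul_comm, smul_smul,
        mul_assoc, mul_add, pow_add, mul_one]
  let e : ℕ → 𝕂 := fun n => Nat.rec 1 (fun k x => x * q ^ (2 * k) / (1 - q ^ (2 * k + 2))) n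
  have he (n : ℕ) : e (n + 1) * (q ^ (2 * n + 2) - 1) + e n * q ^ (2 * n) = 0 := by
    have h : 1 - q ^ (2 * n + 2) ≠ 0 := sub_ne_zero.2 (hq _ (by omega)).symm
    have hs : e (n + 1) = e n * q ^ (2 * n) / (1 - q ^ (2 * n + 2)) := rfl
    rw [hs]
    field_simp
    ring
  have htel (k : ℕ) :
      (B + N * B) * (∑ n ∈ Finset.range (k + 1), e n • N ^ n)
        - (∑ n ∈ Finset.range (k + 1), e n • N ^ n) * B
        = (e k * q ^ (2 * k)) • (N ^ (k + 1) * B) := by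
    induction k with
    | zero => simp [e]
    | succ k ih =>
      rw [Finset.sum_range_succ, mul_add, add_mul _ _ B, add_sub_add_comm, ih, mul_smul_comm,
        add_mul, mul_assoc N, hpow, mul_smul_comm, ← mul_assoc, ← pow_succ', smul_mul_assoc,
        smul_add, smul_smul, smul_smul, add_sub_right_comm, ← add_assoc, ← sub_smul, ← add_smul]
      rw [show e k * q ^ (2 * k) + (e (k + 1) * q ^ (2 * (k + 1)) - e (k + 1)) = 0 by
        linear_combination he k, zero_smul, zero_add]
  refine ⟨∑ n ∈ Finset.range (m + 1), e n • N ^ n, ?_, ?_⟩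
  · rw [Finset.sum_range_succ']
    have hnil : IsNilpotent (∑ n ∈ Finset.range m, e (n + 1) • N ^ (n + 1)) := by
      have hfac : ∑ n ∈ Finset.range m, e (n + 1) • N ^ (n + 1)
          = N * ∑ n ∈ Finset.range m, e (n + 1) • N ^ n := by
        simp [Finset.mul_sum, pow_succ']
      rw [hfac]
      refine Commute.isNilpotent_mul_right ?_ ⟨m + 1, hN⟩
      exact Commute.sum_right _ _ _ fun n _ => ((Commute.refl N).pow_right n).smul_right _
    simpa [e] using hnil.isUnit_add_one
  · rw [← sub_eq_zero, htel, hN, zero_mul, smul_zero]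

/-- If `B` acts as the scalar `c i` on the `i`-th summand of a direct sum decomposition, the
components of a vector in the kernel of `B - μ` are killed by the scalars `c i - μ`. -/
theorem smul_component_eq_zero_of_mem_ker {𝕂 V ι : Type*} [Field 𝕂] [AddCommGroup V]
    [Module 𝕂 V] [DecidableEq ι] {W : ι → Submodule 𝕂 V} (hW : DirectSum.IsInternal W)
    {B : Module.End 𝕂 V} {c : ι → 𝕂} (hB : ∀ i, ∀ v ∈ W i, B v = c i • v) {μ : 𝕂}
    (x : DirectSum ι fun i => W i)
    (hx : DirectSum.coeLinearMap W x ∈ LinearMap.ker (B - μ • (1 : Module.End 𝕂 V))) (i : ι) :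
    (c i - μ) • x i = 0 := by
  let T : (DirectSum ι fun i => W i) →ₗ[𝕂] DirectSum ι fun i => W i :=
    DirectSum.lmap fun i => (c i - μ) • LinearMap.id
  have hT : DirectSum.coeLinearMap W ∘ₗ T
      = (B - μ • (1 : Module.End 𝕂 V)) ∘ₗ DirectSum.coeLinearMap W := by
    refine DirectSum.linearMap_ext _ fun i => LinearMap.ext fun v => ?_
    simp [T, DirectSum.lmap_lof, hB i v v.2, sub_smul]
  have h0 : T x = 0 := hW.injective <| by
    have := LinearMap.congr_fun hT x
    rw [LinearMap.mem_ker] at hx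
    rw [LinearMap.comp_apply, LinearMap.comp_apply, hx] at this
    exact this.trans (map_zero _).symm
  simpa [T, DirectSum.lmap_apply] using congrArg (fun y => y i) h0

theorem stmt_0
    {𝕂 : Type*} [Field 𝕂] [IsAlgClosed 𝕂]
    {q : 𝕂} (hq0 : q ≠ 0) (hqru : ∀ n : ℕ, 0 < n → q ^ n ≠ 1)
    {V : Type*} [AddCommGroup V] [Module 𝕂 V] [FiniteDimensional 𝕂 V]
    (hVpos : 0 < Module.finrank 𝕂 V)
    {d : ℕ} {U : ℤ → Submodule 𝕂 V}
    (hUne : ∀ i : ℤ, 0 ≤ i → i ≤ (d : ℤ) → U i ≠ ⊥)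
    (hUout : ∀ i : ℤ, i < 0 ∨ (d : ℤ) < i → U i = ⊥)
    (hUint : DirectSum.IsInternal (fun i : Fin (d + 1) => U ((i : ℕ) : ℤ)))
    {K Kinv : Module.End 𝕂 V}
    (hKKinv : K * Kinv = 1) (hKinvK : Kinv * K = 1)
    (hK : ∀ i : ℤ, ∀ v ∈ U i, K v = q ^ (2 * i - (d : ℤ)) • v)
    {R L : Module.End 𝕂 V}
    (hR : ∀ i : ℤ, Submodule.map R (U i) ≤ U (i + 1))
    (hL : ∀ i : ℤ, Submodule.map L (U i) ≤ U (i - 1))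
    (hRbij : ∀ i : ℕ, 2 * i ≤ d →
      (∀ v ∈ U (i : ℤ), (R ^ (d - 2 * i)) v = 0 → v = 0) ∧
      (∀ w ∈ U ((d - i : ℕ) : ℤ), ∃ v ∈ U (i : ℤ), (R ^ (d - 2 * i)) v = w))
    (hLbij : ∀ i : ℕ, 2 * i ≤ d →
      (∀ v ∈ U ((d - i : ℕ) : ℤ), (L ^ (d - 2 * i)) v = 0 → v = 0) ∧
      (∀ w ∈ U (i : ℤ), ∃ v ∈ U ((d - i : ℕ) : ℤ), (L ^ (d - 2 * i)) v = w))
    (hSerreR : R ^ 3 * L - ((q ^ (3 : ℤ) - q ^ (-3 : ℤ)) / (q - q⁻¹)) • (R ^ 2 * L * R)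
      + ((q ^ (3 : ℤ) - q ^ (-3 : ℤ)) / (q - q⁻¹)) • (R * L * R ^ 2) - L * R ^ 3 = 0)
    (hSerreL : L ^ 3 * R - ((q ^ (3 : ℤ) - q ^ (-3 : ℤ)) / (q - q⁻¹)) • (L ^ 2 * R * L)
      + ((q ^ (3 : ℤ) - q ^ (-3 : ℤ)) / (q - q⁻¹)) • (L * R * L ^ 2) - R * L ^ 3 = 0)
    {A : Module.End 𝕂 V} (hA : A = K + R)
    :
    DirectSum.IsInternal (fun i : Fin (d + 1) =>
      LinearMap.ker (A - q ^ (2 * ((i : ℕ) : ℤ) - (d : ℤ)) • (1 : Module.End 𝕂 V)))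
    ∧ (∀ μ : 𝕂, LinearMap.ker (A - μ • (1 : Module.End 𝕂 V)) ≠ ⊥ ↔
        ∃ i : ℕ, i ≤ d ∧ μ = q ^ (2 * (i : ℤ) - (d : ℤ)))
    ∧ ∀ i : ℕ, i ≤ d →
        Module.finrank 𝕂 (LinearMap.ker (A - q ^ (2 * (i : ℤ) - (d : ℤ)) • (1 : Module.End 𝕂 V)))
          = Module.finrank 𝕂 (U (i : ℤ)) := by
  have hdist {i j : ℕ} (h : q ^ (2 * (i : ℤ) - (d : ℤ)) = q ^ (2 * (j : ℤ) - (d : ℤ))) :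
      i = j := by
    wlog hij : i < j generalizing i j
    · rcases (not_lt.1 hij).eq_or_lt with hji | hji
      · exact hji.symm
      · exact (this h.symm hji).symm
    refine absurd ?_ (hqru (2 * (j - i)) (by omega))
    rw [← zpow_natCast, show ((2 * (j - i) : ℕ) : ℤ)
      = (2 * (j : ℤ) - (d : ℤ)) - (2 * (i : ℤ) - (d : ℤ)) by omega, zpow_sub₀ hq0, h,
      div_self (zpow_ne_zero _ hq0)]
  have hspan : ⨆ i : Fin (d + 1), U ((i : ℕ) : ℤ) = ⊤ := hUint.submodule_iSup_eq_top
  have hext {S T : Module.End 𝕂 V} (h : ∀ i : ℕ, ∀ v ∈ U (i : ℤ), S v = T v) : S = T := by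
    rw [← LinearMap.eqLocus_eq_top, eq_top_iff, ← hspan]
    exact iSup_le fun i v hv => h i v hv
  have hRmem {i : ℤ} {v : V} (hv : v ∈ U i) : R v ∈ U (i + 1) := hR i ⟨v, hv, rfl⟩
  have hKinv {i : ℤ} {v : V} (hv : v ∈ U i) : Kinv v ∈ U i := by
    have h : Kinv (K v) = v := LinearMap.congr_fun hKinvK v
    rw [hK i v hv, map_smul] at h
    rw [← inv_smul_smul₀ (zpow_ne_zero (2 * i - (d : ℤ)) hq0) (Kinv v), h]
    exact (U i).smul_mem _ hv
  have hKR : K * R = q ^ 2 • (R * K) := hext fun i v hv => by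
    simp only [Module.End.mul_apply, LinearMap.smul_apply]
    rw [hK _ _ (hRmem hv), hK _ _ hv, map_smul, smul_smul, ← zpow_natCast, ← zpow_add₀ hq0]
    congr 2
    push_cast
    ring
  have hKN : K * (R * Kinv) = q ^ 2 • (R * Kinv * K) := by
    rw [← mul_assoc, hKR, smul_mul_assoc, mul_assoc, mul_assoc, hKKinv, hKinvK]
  have hNpow (n : ℕ) {i : ℤ} {v : V} (hv : v ∈ U i) : ((R * Kinv) ^ n) v ∈ U (i + n) := by
    induction n with
    | zero => simpa using hv
    | succ n ih =>
      rw [pow_succ', Nat.cast_succ, ← add_assoc]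
      exact hRmem (hKinv ih)
  have hNnil : (R * Kinv) ^ (d + 1) = 0 := hext fun i v hv => by
    have h := hNpow (d + 1) hv
    rwa [hUout _ (Or.inr (by push_cast; omega)), Submodule.mem_bot] at h
  obtain ⟨_, ⟨E, rfl⟩, hAE⟩ := exists_isUnit_conj_of_q_commute hqru hKN hNnil
  rw [mul_assoc R, hKinvK, mul_one, ← hA] at hAE
  let F : V ≃ₗ[𝕂] V := LinearMap.GeneralLinearGroup.toLinearEquiv E
  have hF (v : V) : A (F v) = F (K v) := LinearMap.congr_fun hAE v
  have hker (μ : 𝕂) : LinearMap.ker (A - μ • (1 : Module.End 𝕂 V))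
      = Submodule.orderIsoMapComap F (LinearMap.ker (K - μ • (1 : Module.End 𝕂 V))) := by
    ext v
    obtain ⟨w, rfl⟩ := F.surjective v
    simp [Submodule.orderIsoMapComap_apply, sub_eq_zero, hF, ← map_smul]
  have hKW (i : Fin (d + 1)) (v : V) (hv : v ∈ U ((i : ℕ) : ℤ)) :
      K v = q ^ (2 * ((i : ℕ) : ℤ) - (d : ℤ)) • v := hK _ v hv
  have hkerK (i : ℕ) (hi : i ≤ d) :
      LinearMap.ker (K - q ^ (2 * (i : ℤ) - (d : ℤ)) • (1 : Module.End 𝕂 V)) = U (i : ℤ) := by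
    refine le_antisymm (fun v hv => ?_) fun v hv => by simp [hK _ v hv]
    obtain ⟨x, rfl⟩ := hUint.surjective v
    have hx := smul_component_eq_zero_of_mem_ker hUint hKW x hv
    have hx' : x = DirectSum.of (fun j : Fin (d + 1) => U ((j : ℕ) : ℤ)) ⟨i, by omega⟩
        (x ⟨i, by omega⟩) := by
      refine DFinsupp.ext fun j => ?_
      by_cases hj : (⟨i, by omega⟩ : Fin (d + 1)) = j
      · subst hj
        exact (DirectSum.of_eq_same (β := fun j : Fin (d + 1) => U ((j : ℕ) : ℤ)) _ _).symm
      · refine ((smul_eq_zero.1 (hx j)).resolve_left fun h => hj ?_).trans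
          (DirectSum.of_eq_of_ne (β := fun j : Fin (d + 1) => U ((j : ℕ) : ℤ)) _ _ _
            (Ne.symm hj)).symm
        exact Fin.ext (hdist (sub_eq_zero.1 h)).symm
    rw [hx', DirectSum.coeAddMonoidHom_of]
    exact (x ⟨i, _⟩).2
  have hkerA (i : ℕ) (hi : i ≤ d) :
      LinearMap.ker (A - q ^ (2 * (i : ℤ) - (d : ℤ)) • (1 : Module.End 𝕂 V))
        = Submodule.orderIsoMapComap F (U (i : ℤ)) := by
    rw [hker, hkerK i hi]
  refine ⟨?_, fun μ => ⟨fun h => ?_, ?_⟩, fun i hi => ?_⟩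
  · simp_rw [fun i : Fin (d + 1) => hkerA i (by omega)]
    refine DirectSum.isInternal_submodule_of_iSupIndep_of_iSup_eq_top
      (hUint.submodule_iSupIndep.map_orderIso _) ?_
    rw [← OrderIso.map_iSup, hspan, OrderIso.map_top]
  · rw [hker, Ne, map_eq_bot_iff, ← Ne, Submodule.ne_bot_iff] at h
    obtain ⟨v, hv, hv0⟩ := h
    obtain ⟨x, rfl⟩ := hUint.surjective v
    have hx := smul_component_eq_zero_of_mem_ker hUint hKW x hv
    by_contra! hμ
    refine hv0 ?_
    have hx0 : x = 0 := DFinsupp.ext fun j =>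
      (smul_eq_zero.1 (hx j)).resolve_left (sub_ne_zero.2 (hμ j (by omega)).symm)
    rw [hx0, map_zero]
  · rintro ⟨i, hi, rfl⟩
    rw [hkerA i hi, Ne, map_eq_bot_iff]
    exact hUne i (by omega) (by omega)
  · rw [hkerA i hi]
    exact F.finrank_map_eq _
end

section
/- For 0 ≤ i ≤ d, the subspaces U_i, U_{d−i}, V_i, V_{d−i} all have the same dimension. -/
theorem exists_isUnit_conj_of_q_commute_s1 {𝕂 E : Type*} [Field 𝕂] [Ring E] [Algebra 𝕂 E]
    {p : 𝕂} (hp : ∀ n : ℕ, 0 < n → p ^ n ≠ 1) {K X : E}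
    (hKX : p • (K * X) = X * K) (hX : IsNilpotent X) :
    ∃ P : E, IsUnit P ∧ K * (1 + X) * P = P * K := by
  obtain ⟨N, hN⟩ := hX
  let c : ℕ → 𝕂 := fun n => ∏ j ∈ Finset.range n, (p ^ (j + 1) - 1)⁻¹
  have hc : ∀ n, c (n + 1) * p ^ (n + 1) = c (n + 1) + c n := by
    intro n
    have h := sub_ne_zero.2 (hp (n + 1) n.succ_pos)
    simp only [c, Finset.prod_range_succ]
    field_simp
    ring
  have hpow : ∀ n, X ^ n * K = p ^ n • (K * X ^ n) := by
    intro n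
    induction n with
    | zero => simp
    | succ n ih =>
      rw [pow_succ, mul_assoc, ← hKX, mul_smul_comm, ← mul_assoc, ih, smul_mul_assoc, smul_smul,
        mul_assoc, pow_succ p, mul_comm p]
  have hpart : ∀ M, K * (1 + X) * (∑ n ∈ Finset.range (M + 1), c n • X ^ n) =
      (∑ n ∈ Finset.range (M + 1), c n • X ^ n) * K + c M • (K * X ^ (M + 1)) := by
    intro M
    induction M with
    | zero => simp [c, mul_add]
    | succ M ih =>
      rw [Finset.sum_range_succ, mul_add, ih, add_mul, smul_mul_assoc, hpow, smul_smul, hc,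
        mul_smul_comm, mul_assoc K, add_mul, one_mul, ← pow_succ', mul_add, add_smul, smul_add]
      abel
  refine ⟨∑ n ∈ Finset.range (N + 1), c n • X ^ n, ?_, ?_⟩
  · rw [Finset.sum_range_succ']
    have hcomm : Commute (∑ n ∈ Finset.range N, c (n + 1) • X ^ n) X :=
      Commute.sum_left _ _ _ fun n _ => ((Commute.refl X).pow_left n).smul_left _
    have : (∑ n ∈ Finset.range N, c (n + 1) • X ^ (n + 1)) =
        (∑ n ∈ Finset.range N, c (n + 1) • X ^ n) * X := by
      simp [Finset.sum_mul, pow_succ]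
    rw [this]
    simpa [c] using (hcomm.isNilpotent_mul_left ⟨N, hN⟩).isUnit_add_one
  · rw [hpart, pow_succ, hN]
    simp

theorem finrank_eigenspace_eq_of_conj {𝕂 V : Type*} [Field 𝕂] [AddCommGroup V] [Module 𝕂 V]
    {f g P : Module.End 𝕂 V} (hP : IsUnit P) (h : g * P = P * f) (μ : 𝕂) :
    Module.finrank 𝕂 (f.eigenspace μ) = Module.finrank 𝕂 (g.eigenspace μ) := by
  have hb := (Module.End.isUnit_iff P).1 hP
  have hv (v : V) : g (P v) = P (f v) := LinearMap.congr_fun h v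
  have : (f.eigenspace μ).map P = g.eigenspace μ := by
    ext w
    obtain ⟨v, rfl⟩ := hb.2 w
    simp only [Submodule.mem_map, Module.End.mem_eigenspace_iff]
    refine ⟨?_, fun hw => ⟨v, ?_, rfl⟩⟩
    · rintro ⟨v', hv', he⟩
      rw [← he, hv, hv', map_smul]
    · exact hb.1 (by rw [← hv, hw, map_smul])
  rw [← this]
  exact (Submodule.equivMapOfInjective P hb.1 _).finrank_eq


theorem stmt_1
    {𝕂 : Type*} [Field 𝕂] [IsAlgClosed 𝕂]
    {q : 𝕂} (hq0 : q ≠ 0) (hqru : ∀ n : ℕ, 0 < n → q ^ n ≠ 1)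
    {V : Type*} [AddCommGroup V] [Module 𝕂 V] [FiniteDimensional 𝕂 V]
    (hVpos : 0 < Module.finrank 𝕂 V)
    {d : ℕ} {U : ℤ → Submodule 𝕂 V}
    (hUne : ∀ i : ℤ, 0 ≤ i → i ≤ (d : ℤ) → U i ≠ ⊥)
    (hUout : ∀ i : ℤ, i < 0 ∨ (d : ℤ) < i → U i = ⊥)
    (hUint : DirectSum.IsInternal (fun i : Fin (d + 1) => U ((i : ℕ) : ℤ)))
    {K Kinv : Module.End 𝕂 V}
    (hKKinv : K * Kinv = 1) (hKinvK : Kinv * K = 1)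
    (hK : ∀ i : ℤ, ∀ v ∈ U i, K v = q ^ (2 * i - (d : ℤ)) • v)
    {R L : Module.End 𝕂 V}
    (hR : ∀ i : ℤ, Submodule.map R (U i) ≤ U (i + 1))
    (hL : ∀ i : ℤ, Submodule.map L (U i) ≤ U (i - 1))
    (hRbij : ∀ i : ℕ, 2 * i ≤ d →
      (∀ v ∈ U (i : ℤ), (R ^ (d - 2 * i)) v = 0 → v = 0) ∧
      (∀ w ∈ U ((d - i : ℕ) : ℤ), ∃ v ∈ U (i : ℤ), (R ^ (d - 2 * i)) v = w))
    (hLbij : ∀ i : ℕ, 2 * i ≤ d →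
      (∀ v ∈ U ((d - i : ℕ) : ℤ), (L ^ (d - 2 * i)) v = 0 → v = 0) ∧
      (∀ w ∈ U (i : ℤ), ∃ v ∈ U ((d - i : ℕ) : ℤ), (L ^ (d - 2 * i)) v = w))
    (hSerreR : R ^ 3 * L - ((q ^ (3 : ℤ) - q ^ (-3 : ℤ)) / (q - q⁻¹)) • (R ^ 2 * L * R)
      + ((q ^ (3 : ℤ) - q ^ (-3 : ℤ)) / (q - q⁻¹)) • (R * L * R ^ 2) - L * R ^ 3 = 0)
    (hSerreL : L ^ 3 * R - ((q ^ (3 : ℤ) - q ^ (-3 : ℤ)) / (q - q⁻¹)) • (L ^ 2 * R * L)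
      + ((q ^ (3 : ℤ) - q ^ (-3 : ℤ)) / (q - q⁻¹)) • (L * R * L ^ 2) - R * L ^ 3 = 0)
    {A : Module.End 𝕂 V} (hA : A = K + R)
    {Vsp : ℤ → Submodule 𝕂 V}
    (hVsp : ∀ i : ℤ, 0 ≤ i → i ≤ (d : ℤ) →
      Vsp i = LinearMap.ker (A - q ^ (2 * i - (d : ℤ)) • (1 : Module.End 𝕂 V)))
    (hVspout : ∀ i : ℤ, i < 0 ∨ (d : ℤ) < i → Vsp i = ⊥)
    :
    ∀ i : ℕ, i ≤ d →
      Module.finrank 𝕂 (U (i : ℤ)) = Module.finrank 𝕂 (U ((d - i : ℕ) : ℤ)) ∧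
      Module.finrank 𝕂 (U (i : ℤ)) = Module.finrank 𝕂 (Vsp (i : ℤ)) ∧
      Module.finrank 𝕂 (U (i : ℤ)) = Module.finrank 𝕂 (Vsp ((d - i : ℕ) : ℤ)) := by
  have hθ : Function.Injective fun i : ℤ => q ^ (2 * i - (d : ℤ)) := by
    have hzpow : ∀ n : ℤ, 0 < n → q ^ n ≠ 1 := by
      intro n hn h
      lift n to ℕ using hn.le
      exact hqru n (by exact_mod_cast hn) (by simpa using h)
    have hlt : ∀ i j : ℤ, i < j → q ^ (2 * i - (d : ℤ)) ≠ q ^ (2 * j - (d : ℤ)) := by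
      intro i j hij h
      refine hzpow (2 * (j - i)) (by omega) ?_
      rw [show 2 * (j - i) = (2 * j - (d : ℤ)) - (2 * i - d) by ring, zpow_sub₀ hq0, h,
        div_self (zpow_ne_zero _ hq0)]
    intro i j h
    by_contra hne
    rcases lt_or_gt_of_ne hne with hij | hij
    · exact hlt i j hij h
    · exact hlt j i hij h.symm
  have htop : ⨆ i : ℤ, U i = ⊤ :=
    top_le_iff.1 (hUint.submodule_iSup_eq_top ▸ iSup_le fun i => le_iSup U _)
  have hUeig (i : ℤ) : U i = K.eigenspace (q ^ (2 * i - (d : ℤ))) :=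
    congrFun (((K.eigenspaces_iSupIndep.comp hθ).le_iff_eq_of_iSup_eq_top htop).1
      fun i v hv => Module.End.mem_eigenspace_iff.2 (hK i v hv)) i
  have hext {f g : Module.End 𝕂 V} (h : ∀ i, ∀ v ∈ U i, f v = g v) : f = g := by
    ext v
    have hv : v ∈ ⨆ i, U i := htop ▸ Submodule.mem_top
    induction hv using Submodule.iSup_induction' with
    | mem i x hx => exact h i x hx
    | zero => simp
    | add x y _ _ hx hy => rw [map_add, map_add, hx, hy]
  have hRU (i : ℤ) {v : V} (hv : v ∈ U i) : R v ∈ U (i + 1) :=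
    hR i (Submodule.mem_map_of_mem hv)
  have hKR : K * R = q ^ 2 • (R * K) := by
    refine hext fun i v hv => ?_
    simp only [Module.End.mul_apply, LinearMap.smul_apply]
    rw [hK _ _ (hRU i hv), hK i v hv, map_smul, smul_smul, ← zpow_natCast, ← zpow_add₀ hq0]
    congr 2
    push_cast
    ring
  have hKX : q⁻¹ ^ 2 • (K * (Kinv * R)) = Kinv * R * K := by
    have : R * K = q⁻¹ ^ 2 • (K * R) := by
      rw [hKR, smul_smul, ← mul_pow, inv_mul_cancel₀ hq0, one_pow, one_smul]
    rw [mul_assoc, this, mul_smul_comm, ← mul_assoc, ← mul_assoc, hKKinv, hKinvK]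
  have hKinvU (i : ℤ) {v : V} (hv : v ∈ U i) : Kinv v ∈ U i := by
    have h : Kinv (K v) = v := LinearMap.congr_fun hKinvK v
    rw [hK i v hv, map_smul] at h
    exact (Submodule.smul_mem_iff _ (zpow_ne_zero _ hq0)).1 (h.symm ▸ hv)
  have hpowU {T : Module.End 𝕂 V} (hT : ∀ i : ℤ, ∀ v ∈ U i, T v ∈ U (i + 1)) (n : ℕ) (i : ℤ)
      {v : V} (hv : v ∈ U i) : (T ^ n) v ∈ U (i + n) := by
    induction n with
    | zero => simpa using hv
    | succ n ih =>
      rw [pow_succ', Nat.cast_succ, ← add_assoc]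
      exact hT _ _ ih
  have hXnil : IsNilpotent (Kinv * R) := by
    refine ⟨d + 1, hext fun i v hv => ?_⟩
    by_cases hi : i < 0
    · have : v = 0 := by simpa [hUout i (Or.inl hi)] using hv
      simp [this]
    · have := hpowU (T := Kinv * R) (fun j v hv => hKinvU _ (hRU j hv)) (d + 1) i hv
      rw [hUout _ (Or.inr (by push_cast; omega))] at this
      simpa using this
  obtain ⟨P, hP, hconj⟩ := exists_isUnit_conj_of_q_commute_s1 (p := q⁻¹ ^ 2)
    (fun n hn => by
      rw [← pow_mul, inv_pow]
      exact fun h => hqru (2 * n) (by omega) (inv_eq_one.1 h)) hKX hXnil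
  rw [mul_add, mul_one, ← mul_assoc, hKKinv, one_mul, ← hA] at hconj
  have hUV (i : ℕ) (hi : i ≤ d) : Module.finrank 𝕂 (U (i : ℤ)) = Module.finrank 𝕂 (Vsp i) := by
    rw [hUeig, finrank_eigenspace_eq_of_conj hP hconj, hVsp i (by omega) (by omega),
      Module.End.eigenspace_def]
  have hUU (i : ℕ) (hi : 2 * i ≤ d) :
      Module.finrank 𝕂 (U (i : ℤ)) = Module.finrank 𝕂 (U ((d - i : ℕ) : ℤ)) := by
    obtain ⟨hinj, hsurj⟩ := hRbij i hi
    have hidx : (i : ℤ) + ((d - 2 * i : ℕ) : ℤ) = ((d - i : ℕ) : ℤ) := by omega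
    let φ : U (i : ℤ) →ₗ[𝕂] U ((d - i : ℕ) : ℤ) :=
      (R ^ (d - 2 * i)).restrict fun v hv => hidx ▸ hpowU (fun j v hv => hRU j hv) (d - 2 * i) i hv
    refine (LinearEquiv.ofBijective φ ⟨?_, ?_⟩).finrank_eq
    · refine (injective_iff_map_eq_zero φ).2 fun v hv => Subtype.ext ?_
      exact hinj v v.2 (congrArg Subtype.val hv)
    · rintro ⟨w, hw⟩
      obtain ⟨v, hv, hvw⟩ := hsurj w hw
      exact ⟨⟨v, hv⟩, Subtype.ext hvw⟩
  intro i hi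
  have hsymm : Module.finrank 𝕂 (U (i : ℤ)) = Module.finrank 𝕂 (U ((d - i : ℕ) : ℤ)) := by
    by_cases h : 2 * i ≤ d
    · exact hUU i h
    · have := hUU (d - i) (by omega)
      rw [Nat.sub_sub_self hi] at this
      exact this.symm
  exact ⟨hsymm, hUV i hi, hsymm.trans (hUV (d - i) (Nat.sub_le d i))⟩
end

section
/- For 0 ≤ i, j ≤ d: (A − q^{2j−d}I) W(i,j) ⊆ W(i+1, j−1) and (K^{−1} − q^{d−2i}I) W(i,j) ⊆ W(i−1, j+1). -/
/-- If `f` maps every `U h` with `h ∈ s` into `N`, it maps their sum into `N`. -/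
theorem apply_mem_of_mem_biSup {𝕂 V ι : Type*} [Field 𝕂] [AddCommGroup V] [Module 𝕂 V]
    {U : ι → Submodule 𝕂 V} {s : Finset ι} {N : Submodule 𝕂 V} {f : Module.End 𝕂 V}
    (h : ∀ i ∈ s, ∀ v ∈ U i, f v ∈ N) {v : V} (hv : v ∈ ⨆ i ∈ s, U i) : f v ∈ N :=
  (iSup₂_le h : (⨆ i ∈ s, U i) ≤ N.comap f) hv

theorem mem_biSup_of_mem_piece {𝕂 V ι : Type*} [Field 𝕂] [AddCommGroup V] [Module 𝕂 V]
    {U : ι → Submodule 𝕂 V} {s : Finset ι} {i : ι} (hi : i ∈ s) {v : V} (hv : v ∈ U i) :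
    v ∈ ⨆ i ∈ s, U i :=
  (le_iSup₂ (f := fun i (_ : i ∈ s) => U i) i hi) hv

theorem zpow_ne_zpow_of_not_root_of_unity {𝕂 : Type*} [Field 𝕂] {q : 𝕂} (hq0 : q ≠ 0)
    (hqru : ∀ n : ℕ, 0 < n → q ^ n ≠ 1) {m n : ℤ} (hmn : m < n) : q ^ n ≠ q ^ m := by
  intro h
  apply hqru (n - m).toNat (by omega)
  rw [← zpow_natCast, Int.toNat_of_nonneg (by omega), zpow_sub₀ hq0, h,
    div_self (zpow_ne_zero _ hq0)]

/-- If `A` raises a finite filtration by a shift of `U` up to the scalars `θ i`, an eigenvector of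
`A` for an eigenvalue different from all `θ i` vanishes. -/
theorem eq_zero_of_apply_eq_smul {𝕂 V : Type*} [Field 𝕂] [AddCommGroup V] [Module 𝕂 V]
    {d : ℕ} {U : ℤ → Submodule 𝕂 V} {A : Module.End 𝕂 V} {θ : ℤ → 𝕂} {c : 𝕂}
    (hUtop : ⨆ h ∈ Finset.Icc (0 : ℤ) d, U h = ⊤) (hUout : ∀ i : ℤ, (d : ℤ) < i → U i = ⊥)
    (hA : ∀ i, ∀ v ∈ U i, A v - θ i • v ∈ U (i + 1))
    (hc : ∀ i : ℤ, 0 ≤ i → i ≤ d → c ≠ θ i) {w : V} (hw : A w = c • w) : w = 0 := by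
  have hmem : ∀ n : ℕ, n ≤ d + 1 → w ∈ ⨆ h ∈ Finset.Icc (n : ℤ) d, U h := by
    intro n
    induction n with
    | zero => intro _; simp only [Nat.cast_zero, hUtop, Submodule.mem_top]
    | succ n ih =>
      intro hn
      have hstep := apply_mem_of_mem_biSup (f := A - θ n • (1 : Module.End 𝕂 V))
        (N := ⨆ h ∈ Finset.Icc ((n + 1 : ℕ) : ℤ) d, U h) (fun i hi v hv => ?_) (ih (by omega))
      · simp only [LinearMap.sub_apply, LinearMap.smul_apply, Module.End.one_apply, hw,
          ← sub_smul] at hstep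
        exact (Submodule.smul_mem_iff _
          (sub_ne_zero.2 (hc n (by omega) (by omega)))).1 hstep
      · have hraise : A v - θ i • v ∈ ⨆ h ∈ Finset.Icc ((n + 1 : ℕ) : ℤ) d, U h := by
          rw [Finset.mem_Icc] at hi
          by_cases hid : i + 1 ≤ d
          · exact mem_biSup_of_mem_piece (Finset.mem_Icc.2 ⟨by push_cast; omega, hid⟩) (hA i v hv)
          · have h0 := hA i v hv
            rw [hUout (i + 1) (by omega), Submodule.mem_bot] at h0
            rw [h0]
            exact zero_mem _
        simp only [LinearMap.sub_apply, LinearMap.smul_apply, Module.End.one_apply]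
        rw [Finset.mem_Icc] at hi
        rcases eq_or_lt_of_le hi.1 with rfl | hlt
        · exact hraise
        · have hv' : v ∈ ⨆ h ∈ Finset.Icc ((n + 1 : ℕ) : ℤ) d, U h :=
            mem_biSup_of_mem_piece (Finset.mem_Icc.2 ⟨by push_cast; omega, hi.2⟩) hv
          have hsplit : A v - θ n • v = (A v - θ i • v) + (θ i - θ n) • v := by
            rw [sub_smul]; abel
          rw [hsplit]
          exact add_mem hraise (Submodule.smul_mem _ _ hv')
  simpa using hmem (d + 1) le_rfl


theorem stmt_3
    {𝕂 : Type*} [Field 𝕂] [IsAlgClosed 𝕂]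
    {q : 𝕂} (hq0 : q ≠ 0) (hqru : ∀ n : ℕ, 0 < n → q ^ n ≠ 1)
    {V : Type*} [AddCommGroup V] [Module 𝕂 V] [FiniteDimensional 𝕂 V]
    (hVpos : 0 < Module.finrank 𝕂 V)
    {d : ℕ} {U : ℤ → Submodule 𝕂 V}
    (hUne : ∀ i : ℤ, 0 ≤ i → i ≤ (d : ℤ) → U i ≠ ⊥)
    (hUout : ∀ i : ℤ, i < 0 ∨ (d : ℤ) < i → U i = ⊥)
    (hUint : DirectSum.IsInternal (fun i : Fin (d + 1) => U ((i : ℕ) : ℤ)))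
    {K Kinv : Module.End 𝕂 V}
    (hKKinv : K * Kinv = 1) (hKinvK : Kinv * K = 1)
    (hK : ∀ i : ℤ, ∀ v ∈ U i, K v = q ^ (2 * i - (d : ℤ)) • v)
    {R L : Module.End 𝕂 V}
    (hR : ∀ i : ℤ, Submodule.map R (U i) ≤ U (i + 1))
    (hL : ∀ i : ℤ, Submodule.map L (U i) ≤ U (i - 1))
    (hRbij : ∀ i : ℕ, 2 * i ≤ d →
      (∀ v ∈ U (i : ℤ), (R ^ (d - 2 * i)) v = 0 → v = 0) ∧
      (∀ w ∈ U ((d - i : ℕ) : ℤ), ∃ v ∈ U (i : ℤ), (R ^ (d - 2 * i)) v = w))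
    (hLbij : ∀ i : ℕ, 2 * i ≤ d →
      (∀ v ∈ U ((d - i : ℕ) : ℤ), (L ^ (d - 2 * i)) v = 0 → v = 0) ∧
      (∀ w ∈ U (i : ℤ), ∃ v ∈ U ((d - i : ℕ) : ℤ), (L ^ (d - 2 * i)) v = w))
    (hSerreR : R ^ 3 * L - ((q ^ (3 : ℤ) - q ^ (-3 : ℤ)) / (q - q⁻¹)) • (R ^ 2 * L * R)
      + ((q ^ (3 : ℤ) - q ^ (-3 : ℤ)) / (q - q⁻¹)) • (R * L * R ^ 2) - L * R ^ 3 = 0)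
    (hSerreL : L ^ 3 * R - ((q ^ (3 : ℤ) - q ^ (-3 : ℤ)) / (q - q⁻¹)) • (L ^ 2 * R * L)
      + ((q ^ (3 : ℤ) - q ^ (-3 : ℤ)) / (q - q⁻¹)) • (L * R * L ^ 2) - R * L ^ 3 = 0)
    {A : Module.End 𝕂 V} (hA : A = K + R)
    {Vsp : ℤ → Submodule 𝕂 V}
    (hVsp : ∀ i : ℤ, 0 ≤ i → i ≤ (d : ℤ) →
      Vsp i = LinearMap.ker (A - q ^ (2 * i - (d : ℤ)) • (1 : Module.End 𝕂 V)))
    (hVspout : ∀ i : ℤ, i < 0 ∨ (d : ℤ) < i → Vsp i = ⊥)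
    {W2 : ℤ → ℤ → Submodule 𝕂 V}
    (hW2 : ∀ i j : ℤ, -1 ≤ i → i ≤ (d : ℤ) + 1 → -1 ≤ j → j ≤ (d : ℤ) + 1 →
      W2 i j = (⨆ h ∈ Finset.Icc (0 : ℤ) i, U h) ⊓ (⨆ h ∈ Finset.Icc (0 : ℤ) j, Vsp h))
    :
    ∀ i j : ℤ, 0 ≤ i → i ≤ (d : ℤ) → 0 ≤ j → j ≤ (d : ℤ) →
      (∀ v ∈ W2 i j, (A - q ^ (2 * j - (d : ℤ)) • (1 : Module.End 𝕂 V)) v ∈ W2 (i + 1) (j - 1)) ∧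
      (∀ v ∈ W2 i j, (Kinv - q ^ ((d : ℤ) - 2 * i) • (1 : Module.End 𝕂 V)) v ∈ W2 (i - 1) (j + 1)) := by
  intro i j hi0 hid hj0 hjd
  have hUtop : ⨆ h ∈ Finset.Icc (0 : ℤ) d, U h = ⊤ := by
    rw [eq_top_iff, ← hUint.submodule_iSup_eq_top]
    refine iSup_le fun k => ?_
    exact le_iSup₂ (f := fun h (_ : h ∈ Finset.Icc (0 : ℤ) d) => U h) ((k : ℕ) : ℤ)
      (Finset.mem_Icc.2 ⟨by omega, by omega⟩)
  have hRU : ∀ i, ∀ v ∈ U i, R v ∈ U (i + 1) := fun i v hv =>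
    hR i (Submodule.mem_map_of_mem hv)
  have hAU : ∀ i, ∀ v ∈ U i, A v - q ^ (2 * i - (d : ℤ)) • v ∈ U (i + 1) := by
    intro i v hv
    rw [hA, LinearMap.add_apply, hK i v hv, add_sub_cancel_left]
    exact hRU i v hv
  have hKinvK' : ∀ v, Kinv (K v) = v := fun v => LinearMap.congr_fun hKinvK v
  have hKKinv' : ∀ v, K (Kinv v) = v := fun v => LinearMap.congr_fun hKKinv v
  have hKinvU : ∀ i, ∀ v ∈ U i, Kinv v = q ^ ((d : ℤ) - 2 * i) • v := by
    intro i v hv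
    have h1 : v = q ^ (2 * i - (d : ℤ)) • Kinv v := by
      rw [← map_smul, ← hK i v hv, hKinvK']
    nth_rewrite 2 [h1]
    rw [smul_smul, ← zpow_add₀ hq0]
    simp
  have hKR : ∀ v, R (Kinv v) = q ^ (2 : ℤ) • Kinv (R v) := by
    intro v
    have hv : v ∈ ⨆ h ∈ Finset.Icc (0 : ℤ) d, U h := hUtop ▸ Submodule.mem_top
    have h0 := apply_mem_of_mem_biSup (f := R * Kinv - q ^ (2 : ℤ) • (Kinv * R)) (N := ⊥)
      (fun i _ v hv => ?_) hv
    · simpa [sub_eq_zero] using h0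
    · simp only [LinearMap.sub_apply, LinearMap.smul_apply, Module.End.mul_apply,
        Submodule.mem_bot]
      rw [hKinvU i v hv, hKinvU (i + 1) _ (hRU i v hv), map_smul, smul_smul, ← zpow_add₀ hq0,
        sub_eq_zero]
      congr 2
      ring
  have hAKinv : ∀ v, A (Kinv v) = q ^ (2 : ℤ) • Kinv (A v) + (1 - q ^ (2 : ℤ)) • v := by
    intro v
    simp only [hA, LinearMap.add_apply, map_add, hKR, hKKinv', hKinvK']
    module
  have hVmem : ∀ h : ℤ, 0 ≤ h → h ≤ d → ∀ v, v ∈ Vsp h ↔ A v = q ^ (2 * h - (d : ℤ)) • v := by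
    intro h h0 hd v
    rw [hVsp h h0 hd]
    simp [sub_eq_zero]
  have hKinvV : ∀ h : ℤ, 0 ≤ h → h ≤ d → ∀ v ∈ Vsp h,
      Kinv v - q ^ ((d : ℤ) - 2 * h) • v ∈ Vsp (h + 1) := by
    intro h h0 hd v hv
    rw [hVmem h h0 hd] at hv
    have hz : A (Kinv v - q ^ ((d : ℤ) - 2 * h) • v) =
        q ^ (2 * (h + 1) - (d : ℤ)) • (Kinv v - q ^ ((d : ℤ) - 2 * h) • v) := by
      rw [map_sub, hAKinv, map_smul, hv, map_smul, smul_sub, smul_smul, smul_smul, smul_smul,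
        ← zpow_add₀ hq0, ← zpow_add₀ hq0, ← zpow_add₀ hq0,
        show (2 : ℤ) + (2 * h - d) = 2 * (h + 1) - d by ring,
        show (d : ℤ) - 2 * h + (2 * h - d) = 0 by ring,
        show 2 * (h + 1) - (d : ℤ) + (d - 2 * h) = 2 by ring, zpow_zero]
      module
    by_cases hd' : h + 1 ≤ d
    · exact (hVmem (h + 1) (by omega) hd' _).2 hz
    · rw [eq_zero_of_apply_eq_smul hUtop (fun i hi => hUout i (Or.inr hi)) hAU
        (fun k _ _ => zpow_ne_zpow_of_not_root_of_unity hq0 hqru (by omega)) hz]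
      exact zero_mem _
  refine ⟨fun v hv => ?_, fun v hv => ?_⟩
  · rw [hW2 i j (by omega) (by omega) (by omega) (by omega)] at hv
    rw [hW2 (i + 1) (j - 1) (by omega) (by omega) (by omega) (by omega)]
    refine ⟨apply_mem_of_mem_biSup (fun h hh u hu => ?_) hv.1,
      apply_mem_of_mem_biSup (fun h hh u hu => ?_) hv.2⟩ <;> rw [Finset.mem_Icc] at hh
    · have hsplit : (A - q ^ (2 * j - (d : ℤ)) • (1 : Module.End 𝕂 V)) u =
          (A u - q ^ (2 * h - (d : ℤ)) • u) +
            (q ^ (2 * h - (d : ℤ)) - q ^ (2 * j - (d : ℤ))) • u := by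
        simp only [LinearMap.sub_apply, LinearMap.smul_apply, Module.End.one_apply]
        module
      rw [hsplit]
      exact add_mem
        (mem_biSup_of_mem_piece (Finset.mem_Icc.2 ⟨by omega, by omega⟩) (hAU h u hu))
        (Submodule.smul_mem _ _
          (mem_biSup_of_mem_piece (Finset.mem_Icc.2 ⟨by omega, by omega⟩) hu))
    · simp only [LinearMap.sub_apply, LinearMap.smul_apply, Module.End.one_apply,
        (hVmem h hh.1 (by omega) u).1 hu, ← sub_smul]
      rcases eq_or_lt_of_le hh.2 with rfl | hlt
      · simp
      · exact Submodule.smul_mem _ _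
          (mem_biSup_of_mem_piece (Finset.mem_Icc.2 ⟨by omega, by omega⟩) hu)
  · rw [hW2 i j (by omega) (by omega) (by omega) (by omega)] at hv
    rw [hW2 (i - 1) (j + 1) (by omega) (by omega) (by omega) (by omega)]
    refine ⟨apply_mem_of_mem_biSup (fun h hh u hu => ?_) hv.1,
      apply_mem_of_mem_biSup (fun h hh u hu => ?_) hv.2⟩ <;> rw [Finset.mem_Icc] at hh
    · simp only [LinearMap.sub_apply, LinearMap.smul_apply, Module.End.one_apply,
        hKinvU h u hu, ← sub_smul]
      rcases eq_or_lt_of_le hh.2 with rfl | hlt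
      · simp
      · exact Submodule.smul_mem _ _
          (mem_biSup_of_mem_piece (Finset.mem_Icc.2 ⟨by omega, by omega⟩) hu)
    · have hsplit : (Kinv - q ^ ((d : ℤ) - 2 * i) • (1 : Module.End 𝕂 V)) u =
          (Kinv u - q ^ ((d : ℤ) - 2 * h) • u) +
            (q ^ ((d : ℤ) - 2 * h) - q ^ ((d : ℤ) - 2 * i)) • u := by
        simp only [LinearMap.sub_apply, LinearMap.smul_apply, Module.End.one_apply]
        module
      rw [hsplit]
      exact add_mem
        (mem_biSup_of_mem_piece (Finset.mem_Icc.2 ⟨by omega, by omega⟩)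
          (hKinvV h hh.1 (by omega) u hu))
        (Submodule.smul_mem _ _
          (mem_biSup_of_mem_piece (Finset.mem_Icc.2 ⟨by omega, by omega⟩) hu))
end

section
/- The sum W_0 + W_1 + ⋯ + W_d is direct; that is, W_i ∩ (W_0 + ⋯ + W_{i−1}) = 0 for 1 ≤ i ≤ d. -/
/-- The submodule of vectors whose `k`-th component, with respect to the projections `π`,
is killed by `R ^ (d + 1 - r - k)`. -/
def stringFiltration {𝕂 V : Type*} [Field 𝕂] [AddCommGroup V] [Module 𝕂 V]
    (π : ℕ → Module.End 𝕂 V) (R : Module.End 𝕂 V) (d r : ℕ) : Submodule 𝕂 V :=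
  ⨅ k : ℕ, LinearMap.ker (R ^ (d + 1 - r - k) * π k)

section GradedProjections

open Polynomial

variable {𝕂 V : Type*} [Field 𝕂] [AddCommGroup V] [Module 𝕂 V]

theorem exists_projections_of_isInternal {d : ℕ} {U : ℕ → Submodule 𝕂 V}
    (hUint : DirectSum.IsInternal (fun i : Fin (d + 1) => U (i : ℕ)))
    (hUout : ∀ k, d < k → U k = ⊥) :
    ∃ π : ℕ → Module.End 𝕂 V, (∀ k v, π k v ∈ U k) ∧ (∀ k, ∀ v ∈ U k, π k v = v) ∧
      (∀ k l, k ≠ l → ∀ v ∈ U l, π k v = 0) ∧ (∀ v, (∀ k, π k v = 0) → v = 0) := by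
  let e := LinearEquiv.ofBijective
    (DirectSum.coeLinearMap (fun i : Fin (d + 1) => U (i : ℕ))) hUint
  have he : ∀ (i : Fin (d + 1)) (v : V) (hv : v ∈ U i),
      e.symm v = DirectSum.lof 𝕂 (Fin (d + 1)) (fun i => U (i : ℕ)) i ⟨v, hv⟩ := by
    intro i v hv
    rw [LinearEquiv.symm_apply_eq]
    exact (DirectSum.coeLinearMap_lof (fun i : Fin (d + 1) => U (i : ℕ)) i ⟨v, hv⟩).symm
  let π : ℕ → Module.End 𝕂 V := fun k =>
    if h : k < d + 1 then
      (U k).subtype ∘ₗ DirectSum.component 𝕂 (Fin (d + 1)) (fun i => U (i : ℕ)) ⟨k, h⟩ ∘ₗ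
        e.symm.toLinearMap
    else 0
  have hπ : ∀ k (h : k < d + 1) v, π k v = (e.symm v ⟨k, h⟩ : U k) := by
    intro k h v
    simp only [π, dif_pos h]
    rfl
  have hπ0 : ∀ k, ¬ k < d + 1 → π k = 0 := fun k h => by simp only [π, dif_neg h]
  refine ⟨π, ?_, ?_, ?_, ?_⟩
  · intro k v
    by_cases h : k < d + 1
    · rw [hπ k h]
      exact Subtype.property _
    · simp [hπ0 k h]
  · intro k v hv
    by_cases h : k < d + 1
    · rw [hπ k h, he ⟨k, h⟩ v hv, DirectSum.lof_apply]
    · rw [hUout k (by omega), Submodule.mem_bot] at hv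
      simp [hv]
  · intro k l hkl v hv
    by_cases hl : l < d + 1
    · by_cases h : k < d + 1
      · rw [hπ k h, he ⟨l, hl⟩ v hv, DirectSum.lof_eq_of, DirectSum.of_eq_of_ne]
        · rfl
        · simpa [Fin.ext_iff] using hkl
      · simp [hπ0 k h]
    · rw [hUout l (by omega), Submodule.mem_bot] at hv
      simp [hv]
  · intro v hv
    rw [← e.symm.map_eq_zero_iff]
    refine DFinsupp.ext fun i => Subtype.ext ?_
    have := hv i
    rw [hπ i i.2] at this
    exact this

variable {d : ℕ} {U : ℕ → Submodule 𝕂 V} {π : ℕ → Module.End 𝕂 V} {R A : Module.End 𝕂 V}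
  {θ : ℕ → 𝕂}

theorem mem_stringFiltration {r : ℕ} {v : V} :
    v ∈ stringFiltration π R d r ↔ ∀ k, (R ^ (d + 1 - r - k)) (π k v) = 0 := by
  simp [stringFiltration, Submodule.mem_iInf]

theorem pow_apply_eq_zero_of_le {T : Module.End 𝕂 V} {m n : ℕ} (hmn : m ≤ n) {v : V}
    (hv : (T ^ m) v = 0) : (T ^ n) v = 0 := by
  obtain ⟨c, rfl⟩ := Nat.exists_eq_add_of_le' hmn
  rw [pow_add, Module.End.mul_apply, hv, map_zero]

theorem apply_mem_stringFiltration
    (hA0 : ∀ v, π 0 (A v) = θ 0 • π 0 v)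
    (hA1 : ∀ k v, π (k + 1) (A v) = θ (k + 1) • π (k + 1) v + R (π k v))
    {r : ℕ} {v : V} (hv : v ∈ stringFiltration π R d r) : A v ∈ stringFiltration π R d r := by
  rw [mem_stringFiltration] at hv ⊢
  rintro (_ | k)
  · rw [hA0, map_smul, hv, smul_zero]
  · rw [hA1, map_add, map_smul, hv, smul_zero, zero_add, ← Module.End.mul_apply, ← pow_succ]
    exact pow_apply_eq_zero_of_le (by omega) (hv k)

theorem aeval_apply_mem_of_invariant {S : Submodule 𝕂 V} (hS : ∀ v ∈ S, A v ∈ S) (p : 𝕂[X])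
    {v : V} (hv : v ∈ S) : aeval A p v ∈ S := by
  induction p using Polynomial.induction_on' with
  | add p q hp hq => simpa using S.add_mem hp hq
  | monomial n a =>
    rw [aeval_monomial, Module.End.mul_apply, Module.algebraMap_end_apply]
    refine S.smul_mem _ ?_
    induction n with
    | zero => simpa using hv
    | succ n ih => rw [pow_succ', Module.End.mul_apply]; exact hS _ ih

theorem projection_eq_zero_of_mem_stringFiltration
    (hinj : ∀ k, 2 * k ≤ d → ∀ v, (R ^ (d - 2 * k)) (π k v) = 0 → π k v = 0)
    {r k : ℕ} (hkr : k < r) {v : V} (hv : v ∈ stringFiltration π R d r) : π k v = 0 := by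
  rw [mem_stringFiltration] at hv
  by_cases hk : 2 * k ≤ d
  · exact hinj k hk v (pow_apply_eq_zero_of_le (by omega) (hv k))
  · have := hv k
    rwa [show d + 1 - r - k = 0 by omega, pow_zero, Module.End.one_apply] at this

theorem eq_zero_of_mem_stringFiltration_of_apply_eq_smul
    (hinj : ∀ k, 2 * k ≤ d → ∀ v, (R ^ (d - 2 * k)) (π k v) = 0 → π k v = 0)
    (hπ : ∀ v, (∀ k, π k v = 0) → v = 0)
    (hA1 : ∀ k v, π (k + 1) (A v) = θ (k + 1) • π (k + 1) v + R (π k v))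
    (hθ : Function.Injective θ)
    {r : ℕ} {v : V} (hv : v ∈ stringFiltration π R d (r + 1)) (hAv : A v = θ r • v) :
    v = 0 := by
  refine hπ v fun k => ?_
  induction k with
  | zero => exact projection_eq_zero_of_mem_stringFiltration hinj (Nat.succ_pos r) hv
  | succ k ih =>
    by_cases hk : k + 1 < r + 1
    · exact projection_eq_zero_of_mem_stringFiltration hinj hk hv
    · have h := hA1 k v
      rw [hAv, ih, map_zero, add_zero, map_smul, ← sub_eq_zero, ← sub_smul] at h
      refine (smul_eq_zero.mp h).resolve_left (sub_ne_zero.mpr fun h' => ?_)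
      have := hθ h'
      omega

theorem projection_aeval_prod_apply
    (hA1 : ∀ k v, π (k + 1) (A v) = θ (k + 1) • π (k + 1) v + R (π k v))
    {i : ℕ} {v : V} (hv : ∀ k, i < k → π k v = 0) (r n : ℕ) :
    (∀ k, i + n < k → π k (aeval A (∏ l ∈ Finset.Ico r (r + n), (X - C (θ l))) v) = 0) ∧
      π (i + n) (aeval A (∏ l ∈ Finset.Ico r (r + n), (X - C (θ l))) v) = (R ^ n) (π i v) := by
  induction n with
  | zero => simpa using hv
  | succ n ih =>
    rw [← add_assoc r, Finset.prod_Ico_succ_top (by omega), mul_comm, map_mul,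
      Module.End.mul_apply]
    generalize aeval A (∏ l ∈ Finset.Ico r (r + n), (X - C (θ l))) v = w at ih ⊢
    have key : ∀ k, π (k + 1) (aeval A (X - C (θ (r + n))) w) =
        (θ (k + 1) - θ (r + n)) • π (k + 1) w + R (π k w) := by
      intro k
      simp only [map_sub, aeval_X, aeval_C, LinearMap.sub_apply, hA1,
        Module.algebraMap_end_apply, map_smul, sub_smul]
      abel
    constructor
    · rintro (_ | k) hk
      · omega
      · rw [key, ih.1 k (by omega), ih.1 (k + 1) (by omega), smul_zero, map_zero, add_zero]
    · rw [← add_assoc, key, ih.1 _ (by omega), ih.2, smul_zero, zero_add, pow_succ',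
        Module.End.mul_apply]

theorem mem_stringFiltration_succ_of_aeval_prod_apply_mem
    (hmem : ∀ k v, π k v ∈ U k) (hself : ∀ k, ∀ v ∈ U k, π k v = v)
    (hne : ∀ k l, k ≠ l → ∀ v ∈ U l, π k v = 0) (hπ : ∀ v, (∀ k, π k v = 0) → v = 0)
    (hA0 : ∀ v, π 0 (A v) = θ 0 • π 0 v)
    (hA1 : ∀ k v, π (k + 1) (A v) = θ (k + 1) • π (k + 1) v + R (π k v))
    {r n m : ℕ} (hm : m + r + n ≤ d + 1) {v : V} (hv : ∀ k, m ≤ k → π k v = 0)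
    (hP : aeval A (∏ l ∈ Finset.Ico r (r + n), (X - C (θ l))) v ∈
      stringFiltration π R d (r + 1)) :
    v ∈ stringFiltration π R d (r + 1) := by
  induction m generalizing v with
  | zero =>
    rw [hπ v fun k => hv k (Nat.zero_le k)]
    exact Submodule.zero_mem _
  | succ m ih =>
    have htop : π m v ∈ stringFiltration π R d (r + 1) := by
      rw [mem_stringFiltration]
      intro k
      by_cases hk : k = m
      · subst hk
        have h := mem_stringFiltration.mp hP (k + n)
        rw [(projection_aeval_prod_apply hA1 (fun l hl => hv l hl) r n).2,
          ← Module.End.mul_apply, ← pow_add] at h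
        rw [hself k _ (hmem k v)]
        exact pow_apply_eq_zero_of_le (by omega) h
      · rw [hne k m hk _ (hmem m v), map_zero]
    have hrest : v - π m v ∈ stringFiltration π R d (r + 1) := by
      refine ih (by omega) (fun k hk => ?_) ?_
      · by_cases hkm : k = m
        · subst hkm
          rw [map_sub, hself k _ (hmem k v), sub_self]
        · rw [map_sub, hv k (by omega), hne k m hkm _ (hmem m v), sub_zero]
      · rw [map_sub]
        exact Submodule.sub_mem _ hP (aeval_apply_mem_of_invariant
          (fun w hw => apply_mem_stringFiltration hA0 hA1 hw) _ htop)
    simpa using Submodule.add_mem _ hrest htop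

theorem eq_zero_of_aeval_prod_apply_eq_zero
    (hmem : ∀ k v, π k v ∈ U k) (hself : ∀ k, ∀ v ∈ U k, π k v = v)
    (hne : ∀ k l, k ≠ l → ∀ v ∈ U l, π k v = 0) (hπ : ∀ v, (∀ k, π k v = 0) → v = 0)
    (hRpow : ∀ k v, (R ^ (d + 1 - k)) (π k v) = 0)
    (hinj : ∀ k, 2 * k ≤ d → ∀ v, (R ^ (d - 2 * k)) (π k v) = 0 → π k v = 0)
    (hA0 : ∀ v, π 0 (A v) = θ 0 • π 0 v)
    (hA1 : ∀ k v, π (k + 1) (A v) = θ (k + 1) • π (k + 1) v + R (π k v))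
    (hθ : Function.Injective θ)
    {n m : ℕ} (hmn : m + n ≤ d + 1) {v : V} (hv : ∀ k, m ≤ k → π k v = 0)
    (hP : aeval A (∏ l ∈ Finset.Ico 0 n, (X - C (θ l))) v = 0) : v = 0 := by
  have main : ∀ r, r ≤ n → v ∈ stringFiltration π R d r ∧
      aeval A (∏ l ∈ Finset.Ico r n, (X - C (θ l))) v = 0 := by
    intro r
    induction r with
    | zero =>
      refine fun _ => ⟨mem_stringFiltration.mpr fun k => ?_, hP⟩
      simpa using hRpow k v
    | succ r ih =>
      intro hr
      obtain ⟨-, hPr⟩ := ih (by omega)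
      have hmem' : v ∈ stringFiltration π R d (r + 1) := by
        refine mem_stringFiltration_succ_of_aeval_prod_apply_mem (n := n - r) (m := m)
          hmem hself hne hπ hA0 hA1 (by omega) hv ?_
        rw [show r + (n - r) = n by omega, hPr]
        exact Submodule.zero_mem _
      refine ⟨hmem', eq_zero_of_mem_stringFiltration_of_apply_eq_smul (r := r) hinj hπ hA1 hθ
        (aeval_apply_mem_of_invariant
          (fun w hw => apply_mem_stringFiltration hA0 hA1 hw) _ hmem') ?_⟩
      rw [Finset.prod_eq_prod_Ico_succ_bot (by omega), map_mul, Module.End.mul_apply] at hPr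
      simpa [sub_eq_zero] using hPr
  simpa using (main n le_rfl).2

end GradedProjections

theorem zpow_two_mul_sub_injective {𝕂 : Type*} [Field 𝕂] {q : 𝕂} (hq0 : q ≠ 0)
    (hqru : ∀ n : ℕ, 0 < n → q ^ n ≠ 1) (d : ℤ) :
    Function.Injective fun k : ℕ => q ^ (2 * (k : ℤ) - d) := by
  have key : ∀ a b : ℕ, a < b → q ^ (2 * (a : ℤ) - d) ≠ q ^ (2 * (b : ℤ) - d) := by
    intro a b hab h
    refine hqru (2 * (b - a)) (by omega) ?_
    have h2 : (2 * (b : ℤ) - d) = (2 * (a : ℤ) - d) + ((2 * (b - a) : ℕ) : ℤ) := by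
      push_cast [hab.le]; ring
    rw [h2, zpow_add₀ hq0, zpow_natCast] at h
    exact (mul_eq_left₀ (zpow_ne_zero _ hq0)).mp h.symm
  intro a b h
  rcases lt_trichotomy a b with hab | hab | hab
  · exact (key a b hab h).elim
  · exact hab
  · exact (key b a hab h.symm).elim


theorem stmt_5
    {𝕂 : Type*} [Field 𝕂] [IsAlgClosed 𝕂]
    {q : 𝕂} (hq0 : q ≠ 0) (hqru : ∀ n : ℕ, 0 < n → q ^ n ≠ 1)
    {V : Type*} [AddCommGroup V] [Module 𝕂 V] [FiniteDimensional 𝕂 V]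
    (hVpos : 0 < Module.finrank 𝕂 V)
    {d : ℕ} {U : ℤ → Submodule 𝕂 V}
    (hUne : ∀ i : ℤ, 0 ≤ i → i ≤ (d : ℤ) → U i ≠ ⊥)
    (hUout : ∀ i : ℤ, i < 0 ∨ (d : ℤ) < i → U i = ⊥)
    (hUint : DirectSum.IsInternal (fun i : Fin (d + 1) => U ((i : ℕ) : ℤ)))
    {K Kinv : Module.End 𝕂 V}
    (hKKinv : K * Kinv = 1) (hKinvK : Kinv * K = 1)
    (hK : ∀ i : ℤ, ∀ v ∈ U i, K v = q ^ (2 * i - (d : ℤ)) • v)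
    {R L : Module.End 𝕂 V}
    (hR : ∀ i : ℤ, Submodule.map R (U i) ≤ U (i + 1))
    (hL : ∀ i : ℤ, Submodule.map L (U i) ≤ U (i - 1))
    (hRbij : ∀ i : ℕ, 2 * i ≤ d →
      (∀ v ∈ U (i : ℤ), (R ^ (d - 2 * i)) v = 0 → v = 0) ∧
      (∀ w ∈ U ((d - i : ℕ) : ℤ), ∃ v ∈ U (i : ℤ), (R ^ (d - 2 * i)) v = w))
    (hLbij : ∀ i : ℕ, 2 * i ≤ d →
      (∀ v ∈ U ((d - i : ℕ) : ℤ), (L ^ (d - 2 * i)) v = 0 → v = 0) ∧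
      (∀ w ∈ U (i : ℤ), ∃ v ∈ U ((d - i : ℕ) : ℤ), (L ^ (d - 2 * i)) v = w))
    (hSerreR : R ^ 3 * L - ((q ^ (3 : ℤ) - q ^ (-3 : ℤ)) / (q - q⁻¹)) • (R ^ 2 * L * R)
      + ((q ^ (3 : ℤ) - q ^ (-3 : ℤ)) / (q - q⁻¹)) • (R * L * R ^ 2) - L * R ^ 3 = 0)
    (hSerreL : L ^ 3 * R - ((q ^ (3 : ℤ) - q ^ (-3 : ℤ)) / (q - q⁻¹)) • (L ^ 2 * R * L)
      + ((q ^ (3 : ℤ) - q ^ (-3 : ℤ)) / (q - q⁻¹)) • (L * R * L ^ 2) - R * L ^ 3 = 0)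
    {A : Module.End 𝕂 V} (hA : A = K + R)
    {Vsp : ℤ → Submodule 𝕂 V}
    (hVsp : ∀ i : ℤ, 0 ≤ i → i ≤ (d : ℤ) →
      Vsp i = LinearMap.ker (A - q ^ (2 * i - (d : ℤ)) • (1 : Module.End 𝕂 V)))
    (hVspout : ∀ i : ℤ, i < 0 ∨ (d : ℤ) < i → Vsp i = ⊥)
    {W : ℤ → Submodule 𝕂 V}
    (hW : ∀ i : ℤ, 0 ≤ i → i ≤ (d : ℤ) →
      W i = (⨆ h ∈ Finset.Icc (0 : ℤ) i, U h) ⊓ (⨆ h ∈ Finset.Icc (0 : ℤ) ((d : ℤ) - i), Vsp h))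
    :
    ∀ i : ℤ, 1 ≤ i → i ≤ (d : ℤ) →
      W i ⊓ (⨆ j ∈ Finset.Icc (0 : ℤ) (i - 1), W j) = ⊥ := by
  obtain ⟨π, hmem, hself, hne, hπ⟩ := exists_projections_of_isInternal
    (U := fun k : ℕ => U (k : ℤ)) hUint (fun k hk => hUout k (Or.inr (by exact_mod_cast hk)))
  have htop : ∀ v : V, v ∈ ⨆ i : Fin (d + 1), U ((i : ℕ) : ℤ) := by
    rw [hUint.submodule_iSup_eq_top]
    exact fun v => Submodule.mem_top
  have hRU : ∀ k : ℕ, ∀ v ∈ U (k : ℤ), R v ∈ U ((k + 1 : ℕ) : ℤ) := by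
    intro k v hv
    have := hR k (Submodule.mem_map_of_mem hv)
    exact_mod_cast this
  have hRπ0 : ∀ v, π 0 (R v) = 0 := by
    intro v
    induction htop v using Submodule.iSup_induction' with
    | mem i v hv => exact hne _ _ (by omega) _ (hRU i v hv)
    | zero => simp
    | add v w _ _ hv hw => rw [map_add, map_add, hv, hw, add_zero]
  have hRπ : ∀ k v, π (k + 1) (R v) = R (π k v) := by
    intro k v
    induction htop v using Submodule.iSup_induction' with
    | mem i v hv =>
      by_cases hk : k = i
      · subst hk
        rw [hself _ _ (hRU _ v hv), hself _ _ hv]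
      · rw [hne _ _ (by omega) _ (hRU _ v hv), hne _ _ hk _ hv, map_zero]
    | zero => simp
    | add v w _ _ hv hw => simp only [map_add, hv, hw]
  have hKπ : ∀ k v, π k (K v) = q ^ (2 * (k : ℤ) - (d : ℤ)) • π k v := by
    intro k v
    induction htop v using Submodule.iSup_induction' with
    | mem i v hv =>
      rw [hK _ v hv, map_smul]
      by_cases hk : k = i
      · rw [hk]
      · rw [hne _ _ hk _ hv, smul_zero, smul_zero]
    | zero => simp
    | add v w _ _ hv hw => simp only [map_add, hv, hw, smul_add]
  have hRpowU : ∀ n k : ℕ, ∀ v ∈ U (k : ℤ), (R ^ n) v ∈ U ((k + n : ℕ) : ℤ) := by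
    intro n k v hv
    induction n with
    | zero => simpa using hv
    | succ n ih => rw [pow_succ', Module.End.mul_apply]; exact hRU _ _ ih
  have hRpow : ∀ k v, (R ^ (d + 1 - k)) (π k v) = 0 := by
    intro k v
    have h := hRpowU (d + 1 - k) k _ (hmem k v)
    rwa [hUout _ (Or.inr (by omega)), Submodule.mem_bot] at h
  intro i hi1 hid
  obtain ⟨m, rfl⟩ : ∃ m : ℕ, i = (m : ℤ) := ⟨i.toNat, by omega⟩
  rw [eq_bot_iff]
  rintro v ⟨hvi, hvs⟩
  rw [SetLike.mem_coe, hW _ (by omega) hid] at hvi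
  have hU : v ∈ ⨆ h ∈ Finset.Icc (0 : ℤ) (m - 1), U h := by
    refine (iSup₂_le fun j hj => ?_ : _ ≤ ⨆ h ∈ Finset.Icc (0 : ℤ) (m - 1), U h) hvs
    rw [Finset.mem_Icc] at hj
    rw [hW j hj.1 (by omega)]
    refine inf_le_left.trans (biSup_mono fun h hh => ?_)
    rw [Finset.mem_Icc] at hh ⊢
    omega
  rw [Submodule.mem_bot]
  refine eq_zero_of_aeval_prod_apply_eq_zero (d := d) (m := m) (n := d + 1 - m) (R := R) (A := A)
    (θ := fun k : ℕ => q ^ (2 * (k : ℤ) - (d : ℤ))) (U := fun k : ℕ => U (k : ℤ))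
    hmem hself hne hπ hRpow (fun k hk v => (hRbij k hk).1 _ (hmem k v)) (fun v => ?_)
    (fun k v => ?_) (zpow_two_mul_sub_injective hq0 hqru d) (by omega) (fun k hk => ?_) ?_
  · rw [hA, LinearMap.add_apply, map_add, hKπ, hRπ0, add_zero]
  · rw [hA, LinearMap.add_apply, map_add, hKπ, hRπ]
  · refine (iSup₂_le fun h hh => ?_ :
      (⨆ h ∈ Finset.Icc (0 : ℤ) (m - 1), U h) ≤ LinearMap.ker (π k)) hU
    rw [Finset.mem_Icc] at hh
    obtain ⟨l, rfl⟩ : ∃ l : ℕ, h = (l : ℤ) := ⟨h.toNat, by omega⟩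
    exact fun w hw => hne k l (by omega) w hw
  · rw [← LinearMap.mem_ker]
    refine (iSup₂_le fun h hh => ?_ :
      (⨆ h ∈ Finset.Icc (0 : ℤ) (d - m), Vsp h) ≤ LinearMap.ker _) hvi.2
    rw [Finset.mem_Icc] at hh
    obtain ⟨l, rfl⟩ : ∃ l : ℕ, h = (l : ℤ) := ⟨h.toNat, by omega⟩
    rw [hVsp _ hh.1 (by omega)]
    intro w hw
    rw [LinearMap.mem_ker, ← Finset.prod_erase_mul _ _
      (Finset.mem_Ico.mpr ⟨Nat.zero_le l, by omega⟩ : l ∈ Finset.Ico 0 (d + 1 - m)),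
      map_mul, Module.End.mul_apply]
    have hw' : Polynomial.aeval A
        (Polynomial.X - Polynomial.C (q ^ (2 * (l : ℤ) - (d : ℤ)))) w = 0 := by
      simpa using hw
    rw [hw', map_zero]
end

section
/- V = W_0 + W_1 + ⋯ + W_d. -/
open Polynomial in
/-- The kernel of a product of linear factors `A - a i` with distinct `a i` is contained in the sum
of the corresponding eigenspaces. -/
theorem ker_aeval_prod_X_sub_C_le {𝕂 V ι : Type*} [Field 𝕂] [AddCommGroup V] [Module 𝕂 V]
    (A : Module.End 𝕂 V) (a : ι → 𝕂) (s : Finset ι) (ha : Set.InjOn a s) :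
    LinearMap.ker (aeval A (∏ i ∈ s, (X - C (a i)))) ≤
      ⨆ i ∈ s, LinearMap.ker (A - a i • (1 : Module.End 𝕂 V)) := by
  classical
  induction s using Finset.induction_on with
  | empty => simp [Module.End.one_eq_id]
  | insert j s hj ih =>
    have hcop : IsCoprime (X - C (a j)) (∏ i ∈ s, (X - C (a i))) := by
      refine IsCoprime.prod_right fun i hi => ?_
      refine isCoprime_X_sub_C_of_isUnit_sub (sub_ne_zero.2 fun h => hj ?_).isUnit
      have := ha (by simp) (by simp [hi]) h
      exact this ▸ hi
    rw [Finset.prod_insert hj, ← sup_ker_aeval_eq_ker_aeval_mul_of_coprime A hcop,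
      Finset.iSup_insert]
    refine sup_le_sup (le_of_eq ?_) (ih (ha.mono (by simp)))
    simp [Algebra.algebraMap_eq_smul_one]

open Polynomial in
theorem aeval_prod_range_X_sub_C_apply {𝕂 V : Type*} [Field 𝕂] [AddCommGroup V] [Module 𝕂 V]
    {A R : Module.End 𝕂 V} {h : V} {b : ℕ → 𝕂}
    (hA : ∀ k, A ((R ^ k) h) = b k • (R ^ k) h + (R ^ (k + 1)) h) (k : ℕ) :
    aeval A (∏ i ∈ Finset.range k, (X - C (b i))) h = (R ^ k) h := by
  induction k with
  | zero => simp
  | succ k ih =>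
    rw [Finset.prod_range_succ, mul_comm, map_mul, Module.End.mul_apply, ih]
    simp [hA]

open Polynomial in
/-- If `A` acts bidiagonally on the string `h, R h, R² h, …`, then a monic product of `n` linear
factors in `A` sends `h` to `Rⁿ h` plus a combination of earlier elements of the string. -/
theorem aeval_prod_X_sub_C_apply_sub_pow_mem {𝕂 V ι : Type*} [Field 𝕂] [AddCommGroup V]
    [Module 𝕂 V] {A R : Module.End 𝕂 V} {h : V} {b : ℕ → 𝕂}
    (hA : ∀ k, A ((R ^ k) h) = b k • (R ^ k) h + (R ^ (k + 1)) h) (c : ι → 𝕂) (s : Finset ι) :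
    aeval A (∏ i ∈ s, (X - C (c i))) h - (R ^ s.card) h ∈
      Submodule.span 𝕂 ((fun k => (R ^ k) h) '' Set.Iio s.card) := by
  classical
  induction s using Finset.induction_on with
  | empty => simp
  | insert j s hj ih =>
    rw [Finset.prod_insert hj, map_mul, Module.End.mul_apply, Finset.card_insert_of_notMem hj]
    set y := aeval A (∏ i ∈ s, (X - C (c i))) h
    set n := s.card
    set S := Submodule.span 𝕂 ((fun k => (R ^ k) h) '' Set.Iio (n + 1))
    have hmem : ∀ k < n + 1, (R ^ k) h ∈ S := fun k hk => Submodule.subset_span ⟨k, hk, rfl⟩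
    have hstep : ∀ k < n, (A - c j • 1) ((R ^ k) h) ∈ S := fun k hk => by
      simp only [LinearMap.sub_apply, hA, LinearMap.smul_apply, Module.End.one_apply]
      exact S.sub_mem (S.add_mem (S.smul_mem _ (hmem k (by lia))) (hmem _ (by lia)))
        (S.smul_mem _ (hmem k (by lia)))
    have hle : Submodule.span 𝕂 ((fun k => (R ^ k) h) '' Set.Iio n) ≤ S.comap (A - c j • 1) := by
      rw [Submodule.span_le]
      rintro _ ⟨k, hk, rfl⟩
      exact hstep k hk
    have h1 : (A - c j • 1) (y - (R ^ n) h) ∈ S := hle ih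
    have h2 : aeval A (X - C (c j)) y - (R ^ (n + 1)) h =
        (A - c j • 1) (y - (R ^ n) h) + (b n - c j) • (R ^ n) h := by
      simp only [map_sub, aeval_X, aeval_C, Algebra.algebraMap_eq_smul_one, LinearMap.sub_apply,
        LinearMap.smul_apply, Module.End.one_apply, hA, sub_smul]
      abel
    rw [h2]
    exact S.add_mem h1 (S.smul_mem _ (hmem n (by lia)))

theorem zpow_injective_of_pow_ne_one {𝕂 : Type*} [Field 𝕂] {q : 𝕂} (hq0 : q ≠ 0)
    (hq : ∀ n : ℕ, 0 < n → q ^ n ≠ 1) : Function.Injective fun n : ℤ => q ^ n := by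
  have key : ∀ a b : ℤ, a < b → q ^ a ≠ q ^ b := by
    intro a b hab h
    refine hq (b - a).toNat (by lia) ?_
    rw [← zpow_natCast, Int.toNat_of_nonneg (by lia), zpow_sub₀ hq0, h,
      div_self (zpow_ne_zero _ hq0)]
  intro a b h
  rcases lt_trichotomy a b with hab | hab | hab
  · exact absurd h (key a b hab)
  · exact hab
  · exact absurd h.symm (key b a hab)

theorem pow_apply_mem_of_map_le {𝕂 V : Type*} [Field 𝕂] [AddCommGroup V] [Module 𝕂 V]
    {R : Module.End 𝕂 V} {U : ℤ → Submodule 𝕂 V}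
    (hR : ∀ i : ℤ, Submodule.map R (U i) ≤ U (i + 1)) {i : ℤ} {v : V} (hv : v ∈ U i) (k : ℕ) :
    (R ^ k) v ∈ U (i + k) := by
  induction k with
  | zero => simpa using hv
  | succ k ih =>
    rw [pow_succ', Module.End.mul_apply]
    have := hR _ (Submodule.mem_map_of_mem ih)
    rwa [add_assoc, ← Nat.cast_succ] at this

/-- A subspace containing all strings `h, R h, R² h, …` with `h ∈ U r` and `R ^ (d - 2 r + 1) h = 0`
contains every `U i`. -/
theorem le_of_forall_string_mem {𝕂 V : Type*} [Field 𝕂] [AddCommGroup V] [Module 𝕂 V]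
    {d : ℕ} {U : ℤ → Submodule 𝕂 V} {R : Module.End 𝕂 V}
    (hUout : ∀ i : ℤ, (d : ℤ) < i → U i = ⊥)
    (hR : ∀ i : ℤ, Submodule.map R (U i) ≤ U (i + 1))
    (hRsurj : ∀ i : ℕ, 2 * i ≤ d →
      ∀ w ∈ U ((d - i : ℕ) : ℤ), ∃ v ∈ U (i : ℤ), (R ^ (d - 2 * i)) v = w)
    {T : Submodule 𝕂 V}
    (hT : ∀ r : ℕ, 2 * r ≤ d → ∀ h ∈ U (r : ℤ), (R ^ (d - 2 * r + 1)) h = 0 →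
      ∀ k : ℕ, (R ^ k) h ∈ T)
    (i : ℕ) (hi : i ≤ d) : U (i : ℤ) ≤ T := by
  have low : ∀ i : ℕ, 2 * i ≤ d → ∀ u ∈ U (i : ℤ), ∀ k : ℕ, (R ^ k) u ∈ T := by
    intro i
    induction i with
    | zero =>
      intro _ u hu k
      refine hT 0 (by lia) u hu ?_ k
      have := pow_apply_mem_of_map_le hR hu (d - 2 * 0 + 1)
      rwa [hUout _ (by push_cast; lia), Submodule.mem_bot] at this
    | succ i ih =>
      intro hi u hu k
      have h1 := pow_apply_mem_of_map_le hR hu (d - 2 * (i + 1) + 1)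
      rw [show ((i + 1 : ℕ) : ℤ) + ((d - 2 * (i + 1) + 1 : ℕ) : ℤ) = ((d - i : ℕ) : ℤ) by lia]
        at h1
      obtain ⟨w, hw, hwu⟩ := hRsurj i (by lia) _ h1
      have hRw : R w ∈ U ((i + 1 : ℕ) : ℤ) := by
        simpa using hR _ (Submodule.mem_map_of_mem hw)
      have h2 : (R ^ (d - 2 * (i + 1) + 1)) (u - R w) = 0 := by
        rw [map_sub, ← hwu, ← Module.End.mul_apply, ← pow_succ,
          show d - 2 * (i + 1) + 1 + 1 = d - 2 * i by lia, sub_self]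
      have h3 := hT (i + 1) hi _ ((U _).sub_mem hu hRw) h2 k
      have h4 := ih (by lia) w hw (k + 1)
      rw [pow_succ, Module.End.mul_apply] at h4
      simpa using T.add_mem h3 h4
  intro u hu
  by_cases h : 2 * i ≤ d
  · simpa using low i h u hu 0
  · obtain ⟨w, hw, rfl⟩ := hRsurj (d - i) (by lia) u (by
      rwa [show d - (d - i) = i by lia])
    exact low (d - i) (by lia) w hw _


theorem stmt_10
    {𝕂 : Type*} [Field 𝕂] [IsAlgClosed 𝕂]
    {q : 𝕂} (hq0 : q ≠ 0) (hqru : ∀ n : ℕ, 0 < n → q ^ n ≠ 1)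
    {V : Type*} [AddCommGroup V] [Module 𝕂 V] [FiniteDimensional 𝕂 V]
    (hVpos : 0 < Module.finrank 𝕂 V)
    {d : ℕ} {U : ℤ → Submodule 𝕂 V}
    (hUne : ∀ i : ℤ, 0 ≤ i → i ≤ (d : ℤ) → U i ≠ ⊥)
    (hUout : ∀ i : ℤ, i < 0 ∨ (d : ℤ) < i → U i = ⊥)
    (hUint : DirectSum.IsInternal (fun i : Fin (d + 1) => U ((i : ℕ) : ℤ)))
    {K Kinv : Module.End 𝕂 V}
    (hKKinv : K * Kinv = 1) (hKinvK : Kinv * K = 1)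
    (hK : ∀ i : ℤ, ∀ v ∈ U i, K v = q ^ (2 * i - (d : ℤ)) • v)
    {R L : Module.End 𝕂 V}
    (hR : ∀ i : ℤ, Submodule.map R (U i) ≤ U (i + 1))
    (hL : ∀ i : ℤ, Submodule.map L (U i) ≤ U (i - 1))
    (hRbij : ∀ i : ℕ, 2 * i ≤ d →
      (∀ v ∈ U (i : ℤ), (R ^ (d - 2 * i)) v = 0 → v = 0) ∧
      (∀ w ∈ U ((d - i : ℕ) : ℤ), ∃ v ∈ U (i : ℤ), (R ^ (d - 2 * i)) v = w))
    (hLbij : ∀ i : ℕ, 2 * i ≤ d →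
      (∀ v ∈ U ((d - i : ℕ) : ℤ), (L ^ (d - 2 * i)) v = 0 → v = 0) ∧
      (∀ w ∈ U (i : ℤ), ∃ v ∈ U ((d - i : ℕ) : ℤ), (L ^ (d - 2 * i)) v = w))
    (hSerreR : R ^ 3 * L - ((q ^ (3 : ℤ) - q ^ (-3 : ℤ)) / (q - q⁻¹)) • (R ^ 2 * L * R)
      + ((q ^ (3 : ℤ) - q ^ (-3 : ℤ)) / (q - q⁻¹)) • (R * L * R ^ 2) - L * R ^ 3 = 0)
    (hSerreL : L ^ 3 * R - ((q ^ (3 : ℤ) - q ^ (-3 : ℤ)) / (q - q⁻¹)) • (L ^ 2 * R * L)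
      + ((q ^ (3 : ℤ) - q ^ (-3 : ℤ)) / (q - q⁻¹)) • (L * R * L ^ 2) - R * L ^ 3 = 0)
    {A : Module.End 𝕂 V} (hA : A = K + R)
    {Vsp : ℤ → Submodule 𝕂 V}
    (hVsp : ∀ i : ℤ, 0 ≤ i → i ≤ (d : ℤ) →
      Vsp i = LinearMap.ker (A - q ^ (2 * i - (d : ℤ)) • (1 : Module.End 𝕂 V)))
    (hVspout : ∀ i : ℤ, i < 0 ∨ (d : ℤ) < i → Vsp i = ⊥)
    {W : ℤ → Submodule 𝕂 V}
    (hW : ∀ i : ℤ, 0 ≤ i → i ≤ (d : ℤ) →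
      W i = (⨆ h ∈ Finset.Icc (0 : ℤ) i, U h) ⊓ (⨆ h ∈ Finset.Icc (0 : ℤ) ((d : ℤ) - i), Vsp h))
    :
    (⨆ i ∈ Finset.Icc (0 : ℤ) (d : ℤ), W i) = ⊤ := by
  open Polynomial in
  set T := ⨆ i ∈ Finset.Icc (0 : ℤ) (d : ℤ), W i
  have string : ∀ r : ℕ, 2 * r ≤ d → ∀ h ∈ U (r : ℤ), (R ^ (d - 2 * r + 1)) h = 0 →
      ∀ k : ℕ, (R ^ k) h ∈ T := by
    intro r hr h hh hzero
    set n := d - 2 * r with hn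
    let b : ℕ → 𝕂 := fun k => q ^ (2 * ((r : ℤ) + k) - (d : ℤ))
    have hAb : ∀ k, A ((R ^ k) h) = b k • (R ^ k) h + (R ^ (k + 1)) h := fun k => by
      rw [hA, LinearMap.add_apply, hK _ _ (pow_apply_mem_of_map_le hR hh k), pow_succ' R,
        Module.End.mul_apply]
    have hb : Function.Injective b := fun i j hij => by
      have := zpow_injective_of_pow_ne_one hq0 hqru hij
      lia
    intro k
    induction k using Nat.strong_induction_on with
    | _ k ih =>
    by_cases hk : n + 1 ≤ k
    · rw [show k = (k - (n + 1)) + (n + 1) by lia, pow_add, Module.End.mul_apply, hzero, map_zero]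
      exact T.zero_mem
    set e := aeval A (∏ i ∈ Finset.Ico (n + 1 - k) (n + 1), (X - C (b i))) h with he
    have hdiff := aeval_prod_X_sub_C_apply_sub_pow_mem hAb b (Finset.Ico (n + 1 - k) (n + 1))
    rw [← he, Nat.card_Ico, show n + 1 - (n + 1 - k) = k by lia] at hdiff
    have hdiffT : e - (R ^ k) h ∈ T := by
      refine (Submodule.span_le.2 ?_) hdiff
      rintro _ ⟨l, hl, rfl⟩
      exact ih l hl
    have hU : ∀ l ≤ k, (R ^ l) h ∈ ⨆ j ∈ Finset.Icc (0 : ℤ) ((r : ℤ) + k), U j := fun l hl =>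
      Submodule.mem_iSup_of_mem _ (Submodule.mem_iSup_of_mem (by simp; lia)
        (pow_apply_mem_of_map_le hR hh l))
    have heU : e ∈ ⨆ j ∈ Finset.Icc (0 : ℤ) ((r : ℤ) + k), U j := by
      rw [← sub_add_cancel e ((R ^ k) h)]
      refine Submodule.add_mem _ ((Submodule.span_le.2 ?_) hdiff) (hU k le_rfl)
      rintro _ ⟨l, hl, rfl⟩
      exact hU l (le_of_lt hl)
    have heker : e ∈ LinearMap.ker (aeval A (∏ i ∈ Finset.range (n + 1 - k), (X - C (b i)))) := by
      rw [LinearMap.mem_ker, he, ← Module.End.mul_apply, ← map_mul,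
        Finset.prod_range_mul_prod_Ico _ (by lia), aeval_prod_range_X_sub_C_apply hAb, hzero]
    have heV : e ∈ ⨆ j ∈ Finset.Icc (0 : ℤ) ((d : ℤ) - ((r : ℤ) + k)), Vsp j := by
      have hsup := ker_aeval_prod_X_sub_C_le A b _ hb.injOn heker
      refine SetLike.le_def.1 (iSup₂_le fun l hl => ?_) hsup
      rw [Finset.mem_range] at hl
      rw [← hVsp ((r : ℤ) + l) (by lia) (by lia)]
      exact le_iSup₂_of_le (f := fun j _ => Vsp j) ((r : ℤ) + l) (by simp; lia) le_rfl
    have heT : e ∈ T := by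
      refine Submodule.mem_iSup_of_mem ((r : ℤ) + k) (Submodule.mem_iSup_of_mem (by simp; lia) ?_)
      rw [hW _ (by lia) (by lia)]
      exact ⟨heU, heV⟩
    simpa using T.sub_mem heT hdiffT
  rw [eq_top_iff, ← hUint.submodule_iSup_eq_top]
  exact iSup_le fun i => le_of_forall_string_mem (fun j hj => hUout j (Or.inr hj)) hR
    (fun j hj => (hRbij j hj).2) string i (by lia)
end

section
/- Then e = e′. -/
section

variable {K A : Type*} [Field K] [Ring A] [Algebra K A]

/-- The iterated `q`-adjoint action of `e` on `d`, where `d` has weight `q ^ 2`. -/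
def qAdIter (q : K) (e d : A) : ℕ → A
  | 0 => d
  | m + 1 => e * qAdIter q e d m - q ^ (2 * m + 2) • (qAdIter q e d m * e)

lemma qAdIter_weight {q : K} {k e d : A} (hke : k * e = q ^ 2 • (e * k))
    (hkd : k * d = q ^ 2 • (d * k)) (m : ℕ) :
    k * qAdIter q e d m = q ^ (2 * m + 2) • (qAdIter q e d m * k) := by
  induction m with
  | zero => simpa [qAdIter] using hkd
  | succ m ih =>
    simp only [qAdIter]
    generalize qAdIter q e d m = x at ih ⊢
    have h1 : k * (e * x) = q ^ (2 * (m + 1) + 2) • (e * (x * k)) := by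
      rw [← mul_assoc, hke, smul_mul_assoc, mul_assoc, ih, mul_smul_comm, smul_smul]
      ring_nf
    have h2 : k * (x * e) = q ^ (2 * (m + 1) + 2) • (x * (e * k)) := by
      rw [← mul_assoc, ih, smul_mul_assoc, mul_assoc, hke, mul_smul_comm, smul_smul]
      ring_nf
    simp only [mul_sub, sub_mul, mul_smul_comm, smul_mul_assoc, h1, h2, mul_assoc]
    module

lemma inv_mul_of_weight {k kinv x : A} {a : K} (ha : a ≠ 0) (hkkinv : k * kinv = 1)
    (hkinvk : kinv * k = 1) (hx : k * x = a • (x * k)) :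
    kinv * x = a⁻¹ • (x * kinv) := by
  have h : x * kinv = a • (kinv * x) := by
    calc x * kinv = kinv * (k * x) * kinv := by rw [← mul_assoc, hkinvk, one_mul]
      _ = a • (kinv * x) := by
        rw [hx, mul_smul_comm, smul_mul_assoc, mul_assoc, mul_assoc, hkkinv, mul_one]
  rw [h, smul_smul, inv_mul_cancel₀ ha, one_smul]

lemma commutator_qAd {k kinv e f x : A} {a s : K} (ha : a ≠ 0) (hkkinv : k * kinv = 1)
    (hkinvk : kinv * k = 1) (hef : e * f - f * e = s • (k - kinv))
    (hx : k * x = a • (x * k)) :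
    f * (e * x - a • (x * e)) - (e * x - a • (x * e)) * f =
      e * (f * x - x * f) - a • ((f * x - x * f) * e) + (s * (a⁻¹ - a)) • (x * kinv) := by
  have hx' := inv_mul_of_weight ha hkkinv hkinvk hx
  have h1 := congrArg (· * x) hef
  have h2 := congrArg (x * ·) hef
  simp only [mul_sub, sub_mul, smul_sub, mul_smul_comm, smul_mul_assoc, hx, hx', mul_assoc]
    at h1 h2 ⊢
  linear_combination (norm := module) a • h2 - h1

lemma commutator_qAdIter {q : K} (hq0 : q ≠ 0) (hq2 : q ^ 2 ≠ 1) {k kinv e f d : A}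
    (hkkinv : k * kinv = 1) (hkinvk : kinv * k = 1)
    (hke : k * e = q ^ 2 • (e * k)) (hkd : k * d = q ^ 2 • (d * k))
    (hef : e * f - f * e = (q - q⁻¹)⁻¹ • (k - kinv)) (hfd : f * d - d * f = 0) (m : ℕ) :
    f * qAdIter q e d (m + 1) - qAdIter q e d (m + 1) * f =
      (-((q ^ (m + 1) - (q ^ (m + 1))⁻¹) * (q ^ (m + 2) - (q ^ (m + 2))⁻¹) /
        (q - q⁻¹) ^ 2)) • (qAdIter q e d m * kinv) := by
  have hs : q - q⁻¹ ≠ 0 := by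
    intro h
    apply hq2
    field_simp at h
    linear_combination h
  have hs' : q ^ 2 - 1 ≠ 0 := sub_ne_zero.mpr hq2
  have hstep := fun n ↦ commutator_qAd (pow_ne_zero (2 * n + 2) hq0) hkkinv hkinvk hef
    (qAdIter_weight hke hkd n)
  induction m with
  | zero =>
    have h := hstep 0
    simp only [qAdIter, hfd, mul_zero, zero_mul, smul_zero, sub_zero, zero_add] at h ⊢
    rw [h]
    congr 1
    field_simp
    ring
  | succ m ih =>
    have h := hstep (m + 1)
    rw [ih] at h
    have hke' := inv_mul_of_weight (pow_ne_zero 2 hq0) hkkinv hkinvk hke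
    rw [qAdIter, h]
    set b := -((q ^ (m + 1) - (q ^ (m + 1))⁻¹) * (q ^ (m + 2) - (q ^ (m + 2))⁻¹) /
        (q - q⁻¹) ^ 2) with hb
    have hx : e * (b • (qAdIter q e d m * kinv)) -
        q ^ (2 * (m + 1) + 2) • (b • (qAdIter q e d m * kinv) * e) =
        b • (qAdIter q e d (m + 1) * kinv) := by
      have hp : q ^ (2 * (m + 1) + 2) * (q ^ 2)⁻¹ = q ^ (2 * m + 2) := by
        field_simp
        ring
      simp only [qAdIter, sub_mul, mul_smul_comm, smul_mul_assoc, mul_assoc, hke', smul_sub,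
        smul_smul, ← hp]
      module
    rw [hx, ← add_smul]
    congr 1
    rw [hb]
    have hs2 : (q ^ 2 - 1) ^ 2 ≠ 0 := pow_ne_zero 2 hs'
    have hqm : q ^ m ≠ 0 := pow_ne_zero m hq0
    have e1 : q - q⁻¹ = (q ^ 2 - 1) / q := by field_simp
    simp only [e1, pow_add, pow_mul', mul_add]
    generalize q ^ m = t at *
    field_simp
    ring

lemma exists_qAdIter_eq_zero [FiniteDimensional K A] {q : K} (hq0 : q ≠ 0)
    (hqru : ∀ n : ℕ, 0 < n → q ^ n ≠ 1) {k kinv e d : A} (hkkinv : k * kinv = 1)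
    (hke : k * e = q ^ 2 • (e * k)) (hkd : k * d = q ^ 2 • (d * k)) :
    ∃ m, qAdIter q e d m = 0 := by
  by_contra! h
  have hinj : Function.Injective fun m : ℕ ↦ q ^ (2 * m + 2) := by
    have key : ∀ m n : ℕ, m < n → q ^ (2 * m + 2) ≠ q ^ (2 * n + 2) := by
      intro m n hmn hq
      apply hqru (2 * (n - m)) (by omega)
      have hn : 2 * n + 2 = 2 * m + 2 + 2 * (n - m) := by omega
      exact mul_left_cancel₀ (pow_ne_zero (2 * m + 2) hq0)
        (by rw [← pow_add, ← hn, mul_one, hq])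
    intro m n hmn
    rcases lt_trichotomy m n with hlt | heq | hlt
    · exact absurd hmn (key m n hlt)
    · exact heq
    · exact absurd hmn.symm (key n m hlt)
  have hli : LinearIndependent K (qAdIter q e d) :=
    Module.End.eigenvectors_linearIndependent' (LinearMap.mulLeftRight K (k, kinv))
      (fun m : ℕ ↦ q ^ (2 * m + 2)) hinj _ fun m ↦ by
        refine ⟨Module.End.mem_eigenspace_iff.mpr ?_, h m⟩
        rw [LinearMap.mulLeftRight_apply, qAdIter_weight hke hkd, smul_mul_assoc, mul_assoc,
          hkkinv, mul_one]
  exact Module.Finite.not_linearIndependent_of_infinite _ hli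

/-- In a finite-dimensional algebra, an element of weight `q ^ 2` commuting with `f` vanishes. -/
lemma eq_zero_of_weight_of_commute [FiniteDimensional K A] {q : K} (hq0 : q ≠ 0)
    (hqru : ∀ n : ℕ, 0 < n → q ^ n ≠ 1) {k kinv e f d : A}
    (hkkinv : k * kinv = 1) (hkinvk : kinv * k = 1)
    (hke : k * e = q ^ 2 • (e * k)) (hkd : k * d = q ^ 2 • (d * k))
    (hef : e * f - f * e = (q - q⁻¹)⁻¹ • (k - kinv)) (hfd : f * d - d * f = 0) : d = 0 := by
  have hne : ∀ n : ℕ, 0 < n → q ^ n - (q ^ n)⁻¹ ≠ 0 := by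
    intro n hn h
    have hqn : q ^ n ≠ 0 := pow_ne_zero n hq0
    apply hqru (n * 2) (by omega)
    rw [pow_mul]
    field_simp at h
    linear_combination h
  have hs : q - q⁻¹ ≠ 0 := by simpa using hne 1 one_pos
  obtain ⟨m, hm⟩ := exists_qAdIter_eq_zero hq0 hqru hkkinv hke hkd
  induction m with
  | zero => exact hm
  | succ m ih =>
    apply ih
    have h := commutator_qAdIter hq0 (hqru 2 two_pos) hkkinv hkinvk hke hkd hef hfd m
    rw [hm, mul_zero, zero_mul, sub_zero] at h
    have hc := (smul_eq_zero.mp h.symm).resolve_left <| neg_ne_zero.mpr <| div_ne_zero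
      (mul_ne_zero (hne _ (by omega)) (hne _ (by omega))) (pow_ne_zero 2 hs)
    calc qAdIter q e d m = qAdIter q e d m * kinv * k := by rw [mul_assoc, hkinvk, mul_one]
      _ = 0 := by rw [hc, zero_mul]

end


theorem stmt_19
    {𝕂 : Type*} [Field 𝕂] [IsAlgClosed 𝕂]
    {q : 𝕂} (hq0 : q ≠ 0) (hqru : ∀ n : ℕ, 0 < n → q ^ n ≠ 1)
    {V : Type*} [AddCommGroup V] [Module 𝕂 V] [FiniteDimensional 𝕂 V]
    {k kinv f e e' : Module.End 𝕂 V}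
    (hkkinv : k * kinv = 1) (hkinvk : kinv * k = 1)
    (hdiag : (⨆ μ : 𝕂, LinearMap.ker (k - μ • (1 : Module.End 𝕂 V))) = ⊤)
    (hkf : k * f = q ^ (-2 : ℤ) • (f * k))
    (hke : k * e = (q ^ 2 : 𝕂) • (e * k))
    (hef : e * f - f * e = (q - q⁻¹)⁻¹ • (k - kinv))
    (hke' : k * e' = (q ^ 2 : 𝕂) • (e' * k))
    (hef' : e' * f - f * e' = (q - q⁻¹)⁻¹ • (k - kinv))
    :
    e = e' := by
  refine sub_eq_zero.mp (eq_zero_of_weight_of_commute hq0 hqru hkkinv hkinvk hke ?_ hef ?_)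
  · rw [mul_sub, sub_mul, smul_sub, hke, hke']
  · rw [mul_sub, sub_mul]
    linear_combination (norm := module) hef' - hef
end
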